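/- arXiv:2203.14594 — 3 statements merged into one kernel-verified Lean document; each statement's English description precedes it below -/
import Mathlib

section
/- Let n ≥ 1 be a natural number, r ∈ (0,1) a real number, v ∈ ℝⁿ, and A a symmetric n×n real matrix. Define: û = r²/√(r² + |v|²); the 'Euclidean Gauss curvature' K̂ = det(−r·A + 2 v vᵀ + r²·Id) / ((r² + |v|²)^{(n+2)/2} · r^{2n−2}); φ = r/√(1−r²); φ' = 1/√(1−r²); the vector p ∈ ℝⁿ with p_i = v_i/(1−r²); the symmetric matrix B with B_{ij} = A_{ij}/(1−r²) + 2r v_i v_j/(1−r²)²; and the 'hyperbolic Gauss curvature' K = det(−φ·B + 2φ'·p pᵀ + φ²φ'·Id) / ((φ² + |p|²)^{(n+2)/2} · φ^{2n−2}). Then K = K̂ · ((1−r²)/(1−û²))^{(n+2)/2}. -/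
/-- Relation `K = Khat ((1-r²)/(1-uhat²))^((n+2)/2)` between the hyperbolic and Euclidean
Gauss curvature determinant formulas of a radial graph and its Klein-model projection. -/
theorem stmt_4 (n : ℕ) (hn : 1 ≤ n) (r : ℝ) (hr : r ∈ Set.Ioo (0 : ℝ) 1)
    (v : Fin n → ℝ) (A : Matrix (Fin n) (Fin n) ℝ) (hA : A.IsSymm)
    (uhat Khat φ φ' K : ℝ) (p : Fin n → ℝ) (B : Matrix (Fin n) (Fin n) ℝ)
    (huhat : uhat = r ^ 2 / Real.sqrt (r ^ 2 + ∑ i, v i ^ 2))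
    (hKhat : Khat = (Matrix.of fun i j : Fin n =>
        -r * A i j + 2 * v i * v j + r ^ 2 * (if i = j then 1 else 0)).det /
        ((r ^ 2 + ∑ i, v i ^ 2) ^ (((n : ℝ) + 2) / 2) * r ^ (2 * n - 2)))
    (hφ : φ = r / Real.sqrt (1 - r ^ 2))
    (hφ' : φ' = 1 / Real.sqrt (1 - r ^ 2))
    (hp : ∀ i, p i = v i / (1 - r ^ 2))
    (hB : ∀ i j, B i j = A i j / (1 - r ^ 2) + 2 * r * v i * v j / (1 - r ^ 2) ^ 2)
    (hK : K = (Matrix.of fun i j : Fin n =>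
        -φ * B i j + 2 * φ' * p i * p j + φ ^ 2 * φ' * (if i = j then 1 else 0)).det /
        ((φ ^ 2 + ∑ i, p i ^ 2) ^ (((n : ℝ) + 2) / 2) * φ ^ (2 * n - 2))) :
    K = Khat * ((1 - r ^ 2) / (1 - uhat ^ 2)) ^ (((n : ℝ) + 2) / 2) := by
  obtain ⟨hr0, hr1⟩ := hr
  have hs : 0 < 1 - r ^ 2 := by nlinarith
  obtain ⟨t, ht⟩ : ∃ t, t = Real.sqrt (1 - r ^ 2) := ⟨_, rfl⟩
  rw [← ht] at hφ hφ'
  have ht0 : 0 < t := ht ▸ Real.sqrt_pos.2 hs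
  have hst : 1 - r ^ 2 = t ^ 2 := by rw [ht, Real.sq_sqrt hs.le]
  obtain ⟨S, hS⟩ : ∃ S, S = ∑ i, v i ^ 2 := ⟨_, rfl⟩
  have hS0 : 0 ≤ S := hS ▸ Finset.sum_nonneg fun i _ => sq_nonneg (v i)
  have hE : 0 < r ^ 2 + S := by positivity
  have hQ : 0 < r ^ 2 * t ^ 2 + S := by positivity
  have hmat : (Matrix.of fun i j : Fin n =>
      -φ * B i j + 2 * φ' * p i * p j + φ ^ 2 * φ' * (if i = j then 1 else 0)) =
      (t ^ 3)⁻¹ • (Matrix.of fun i j : Fin n =>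
        -r * A i j + 2 * v i * v j + r ^ 2 * (if i = j then 1 else 0)) := by
    ext i j
    simp only [Matrix.of_apply, Matrix.smul_apply, smul_eq_mul, hB, hp, hφ, hφ', hst]
    generalize (if i = j then (1 : ℝ) else 0) = d
    field_simp
    linear_combination (2 * v i * v j) * hst
  have hp2 : ∑ i, p i ^ 2 = S / (t ^ 2) ^ 2 := by
    simp only [hp, hst, div_pow, ← Finset.sum_div, hS]
  have hnorm : φ ^ 2 + ∑ i, p i ^ 2 = (r ^ 2 * t ^ 2 + S) / (t ^ 2) ^ 2 := by
    rw [hp2, hφ]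
    field_simp
  have hu : (1 - r ^ 2) / (1 - uhat ^ 2) = t ^ 2 * (r ^ 2 + S) / (r ^ 2 * t ^ 2 + S) := by
    have h : 1 - uhat ^ 2 = (r ^ 2 * t ^ 2 + S) / (r ^ 2 + S) := by
      rw [huhat, ← hS, div_pow, Real.sq_sqrt hE.le, ← hst]
      field_simp
      ring
    rw [h, hst]
    field_simp
  have hpow : (t ^ 2) ^ (((n : ℝ) + 2) / 2) = t ^ (n + 2) := by
    rw [← Real.rpow_natCast t 2, ← Real.rpow_mul ht0.le, ← Real.rpow_natCast t (n + 2)]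
    congr 1
    push_cast
    ring
  have hpow2 : ((t ^ 2) ^ 2) ^ (((n : ℝ) + 2) / 2) = (t ^ (n + 2)) ^ 2 := by
    rw [← hpow, sq (t ^ 2), Real.mul_rpow (by positivity) (by positivity), ← sq]
  rw [hK, hKhat, hmat, hnorm, hu, Matrix.det_smul, Fintype.card_fin, ← hS, hφ,
    Real.div_rpow hQ.le (by positivity), Real.div_rpow (by positivity) hQ.le,
    Real.mul_rpow (by positivity) hE.le, hpow, hpow2]
  have hE' := Real.rpow_pos_of_pos hE (((n : ℝ) + 2) / 2)
  have hQ' := Real.rpow_pos_of_pos hQ (((n : ℝ) + 2) / 2)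
  generalize (r ^ 2 + S) ^ (((n : ℝ) + 2) / 2) = E at *
  generalize (r ^ 2 * t ^ 2 + S) ^ (((n : ℝ) + 2) / 2) = Q at *
  generalize Matrix.det (R := ℝ) (n := Fin n) _ = D
  obtain ⟨k, rfl⟩ : ∃ k, n = k + 1 := ⟨n - 1, by omega⟩
  have hk : 2 * (k + 1) - 2 = 2 * k := by omega
  rw [hk, div_pow, inv_pow]
  field_simp
  ring
end

section
/- Let e₁, e₂ be real numbers with 0 < e₂ < e₁ < 1. Then ∫₀^{2π} log(1 − e₁² + (e₁² − e₂²) sin² v) dv ≥ 2π·log(e₁² − e₂²) − 4π·log 2. -/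
open Real

theorem integral_log_sin_zero_two_pi :
    ∫ x in (0 : ℝ)..(2 * π), Real.log (Real.sin x) = -(2 * π * Real.log 2) := by
  have shift : ∫ x in π..(2 * π), Real.log (Real.sin x) =
      ∫ x in (0 : ℝ)..π, Real.log (Real.sin x) := by
    have h := intervalIntegral.integral_comp_add_right (a := 0) (b := π)
      (fun x ↦ Real.log (Real.sin x)) π
    simp only [Real.sin_add_pi, Real.log_neg_eq_log, zero_add, ← two_mul] at h
    exact h.symm
  rw [← intervalIntegral.integral_add_adjacent_intervals (b := π)
    (by apply intervalIntegrable_log_sin) (by apply intervalIntegrable_log_sin), shift,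
    integral_log_sin_zero_pi]
  ring

theorem ae_sin_ne_zero : ∀ᵐ x : ℝ, Real.sin x ≠ 0 := by
  have h : {x : ℝ | Real.sin x = 0}.Countable :=
    (Set.countable_range fun n : ℤ ↦ (n : ℝ) * π).mono fun x hx ↦ Real.sin_eq_zero_iff.mp hx
  simpa using! h.ae_notMem MeasureTheory.volume

/-- For `0 < e₂ < e₁ < 1`,
`∫₀^{2π} log (1 - e₁² + (e₁² - e₂²) sin² v) dv ≥ 2π log (e₁² - e₂²) - 4π log 2`. -/
theorem stmt_13 (e₁ e₂ : ℝ) (h0 : 0 < e₂) (h1 : e₂ < e₁) (h2 : e₁ < 1) :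
    2 * π * Real.log (e₁ ^ 2 - e₂ ^ 2) - 4 * π * Real.log 2 ≤
      ∫ v in (0 : ℝ)..(2 * π),
        Real.log (1 - e₁ ^ 2 + (e₁ ^ 2 - e₂ ^ 2) * Real.sin v ^ 2) := by
  have hb : 0 < 1 - e₁ ^ 2 := by nlinarith
  have hc : 0 < e₁ ^ 2 - e₂ ^ 2 := by nlinarith
  have hint : IntervalIntegrable (fun v ↦ 2 * Real.log (Real.sin v))
      MeasureTheory.volume 0 (2 * π) :=
    IntervalIntegrable.const_mul (by apply intervalIntegrable_log_sin) 2
  have hcont : Continuous fun v ↦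
      Real.log (1 - e₁ ^ 2 + (e₁ ^ 2 - e₂ ^ 2) * Real.sin v ^ 2) :=
    Continuous.log (by fun_prop) fun v ↦ by positivity
  calc 2 * π * Real.log (e₁ ^ 2 - e₂ ^ 2) - 4 * π * Real.log 2
      = ∫ v in (0 : ℝ)..(2 * π), (Real.log (e₁ ^ 2 - e₂ ^ 2) + 2 * Real.log (Real.sin v)) := by
        rw [intervalIntegral.integral_add intervalIntegrable_const hint,
          intervalIntegral.integral_const, intervalIntegral.integral_const_mul,
          integral_log_sin_zero_two_pi, smul_eq_mul]
        ring
    _ ≤ _ := by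
        refine intervalIntegral.integral_mono_ae (by positivity)
          (intervalIntegrable_const.add hint) (hcont.intervalIntegrable _ _) ?_
        filter_upwards [ae_sin_ne_zero] with v hv
        have hs : 0 < Real.sin v ^ 2 := by positivity
        have hlog : Real.log ((e₁ ^ 2 - e₂ ^ 2) * Real.sin v ^ 2) =
            Real.log (e₁ ^ 2 - e₂ ^ 2) + 2 * Real.log (Real.sin v) := by
          rw [Real.log_mul hc.ne' hs.ne', Real.log_pow, Nat.cast_ofNat]
        rw [← hlog]
        exact Real.log_le_log (by positivity) (by linarith)
end

section
/- Let n ≥ 1 be a natural number, c₁, c₂, c₃ > 0 real constants, T ∈ (0, ∞], and let y : [0, T) → ℝ be differentiable with y(t) > 0 for all t and y'(t) ≥ −c₁·y(t)² − c₂·y(t) + c₃·y(t)^{(n−1)/n} for all t ∈ [0, T). Then there exists a constant c₄ > 0, depending only on c₁, c₂, c₃ and n, such that y(t) ≥ min{y(0), c₄} for all t ∈ [0, T). -/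
open scoped ENNReal

/-- For small `s > 0`, a sublinear power dominates a quadratic polynomial without constant term. -/
theorem exists_forall_quadratic_lt_rpow (n : ℕ) (hn : 1 ≤ n) (c₁ c₂ c₃ : ℝ)
    (hc₁ : 0 < c₁) (hc₂ : 0 < c₂) (hc₃ : 0 < c₃) :
    ∃ c₄ > (0 : ℝ), ∀ s : ℝ, 0 < s → s ≤ c₄ →
      c₁ * s ^ 2 + c₂ * s < c₃ * s ^ (((n : ℝ) - 1) / n) := by
  have hn0 : (n : ℝ) ≠ 0 := by positivity
  set r : ℝ := c₃ / (2 * (c₁ + c₂)) with hr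
  have hr0 : 0 < r := by positivity
  refine ⟨min 1 (r ^ n), lt_min one_pos (by positivity), fun s hs hsc => ?_⟩
  have hs1 : s ≤ 1 := hsc.trans (min_le_left _ _)
  have hroot : s ^ ((n : ℝ)⁻¹) ≤ r := by
    rw [Real.rpow_inv_le_iff_of_pos hs.le hr0.le (by positivity), Real.rpow_natCast]
    exact hsc.trans (min_le_right _ _)
  have hp : 0 < s ^ (((n : ℝ) - 1) / n) := Real.rpow_pos_of_pos hs _
  have hsplit : s = s ^ (((n : ℝ) - 1) / n) * s ^ ((n : ℝ)⁻¹) := by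
    rw [← Real.rpow_add hs, show ((n : ℝ) - 1) / n + (n : ℝ)⁻¹ = 1 by field_simp; ring,
      Real.rpow_one]
  have hcr : (c₁ + c₂) * r = c₃ / 2 := by rw [hr]; field_simp
  calc c₁ * s ^ 2 + c₂ * s ≤ (c₁ + c₂) * s := by nlinarith [mul_pos hc₁ hs]
    _ = (c₁ + c₂) * s ^ ((n : ℝ)⁻¹) * s ^ (((n : ℝ) - 1) / n) := by
      conv_lhs => rw [hsplit]
      ring
    _ ≤ (c₁ + c₂) * r * s ^ (((n : ℝ) - 1) / n) := by gcongr
    _ < c₃ * s ^ (((n : ℝ) - 1) / n) := by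
      rw [hcr]
      gcongr
      linarith

/-- ODE persistence of positivity: if `y > 0` on `[0,T)` satisfies
`y' ≥ -c₁ y² - c₂ y + c₃ y^{(n-1)/n}`, then `y(t) ≥ min (y 0) c₄` for a constant `c₄ > 0`
depending only on `c₁, c₂, c₃, n`. -/
theorem stmt_16 (n : ℕ) (hn : 1 ≤ n) (c₁ c₂ c₃ : ℝ)
    (hc₁ : 0 < c₁) (hc₂ : 0 < c₂) (hc₃ : 0 < c₃) :
    ∃ c₄ > (0 : ℝ), ∀ (T : ℝ≥0∞), 0 < T → ∀ y y' : ℝ → ℝ,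
      (∀ t : ℝ, 0 ≤ t → ENNReal.ofReal t < T →
        HasDerivWithinAt y (y' t) (Set.Ici 0) t) →
      (∀ t : ℝ, 0 ≤ t → ENNReal.ofReal t < T → 0 < y t) →
      (∀ t : ℝ, 0 ≤ t → ENNReal.ofReal t < T →
        -c₁ * y t ^ 2 - c₂ * y t + c₃ * y t ^ (((n : ℝ) - 1) / n) ≤ y' t) →
      ∀ t : ℝ, 0 ≤ t → ENNReal.ofReal t < T → min (y 0) c₄ ≤ y t := by
  obtain ⟨c₄, hc₄, h⟩ := exists_forall_quadratic_lt_rpow n hn c₁ c₂ c₃ hc₁ hc₂ hc₃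
  refine ⟨c₄, hc₄, fun T _ y y' hy hpos hineq t ht htT => ?_⟩
  have hlt : ∀ x ∈ Set.Icc 0 t, ENNReal.ofReal x < T := fun x hx =>
    (ENNReal.ofReal_le_ofReal hx.2).trans_lt htT
  refine image_le_of_deriv_right_lt_deriv_boundary' (f := fun _ => min (y 0) c₄)
    (f' := fun _ => 0) (B' := y') continuousOn_const
    (fun x _ => hasDerivWithinAt_const _ _ _) (min_le_left _ _)
    (fun x hx => (hy x hx.1 (hlt x hx)).continuousWithinAt.mono Set.Icc_subset_Ici_self)
    (fun x hx => (hy x hx.1 (hlt x (Set.Ico_subset_Icc_self hx))).mono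
      (Set.Ici_subset_Ici.2 hx.1))
    (fun x hx hxy => ?_) ⟨ht, le_rfl⟩
  have hxT := hlt x (Set.Ico_subset_Icc_self hx)
  have hsmall := h (y x) (hpos x hx.1 hxT) (hxy.symm.le.trans (min_le_right _ _))
  linarith [hineq x hx.1 hxT]
end
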